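/- Suppose the star-connected occupied component C(0) containing the origin is finite and nonempty. Then an edge e of G_C is an outermost boundary edge of C(0) if and only if e is an edge of the outermost boundary cycle D_k of some occupied square S_k ∈ C(0). -/

import Mathlib

/-!
Common framework: tile ℝ² into closed unit squares indexed by `ℤ²`, with corners
forming a translate of `ℤ²` and the origin the centre of the square `S₀` (index `(0,0)`).
A cycle is identified with its edge set (a set of unordered pairs of corners);
its interior (resp. exterior) is the union of the bounded (resp. unbounded)
connected components of the complement of the closed curve it traces in the plane.
-/

/-- Corners of the grid squares, indexed by `ℤ²`. -/
abbrev GridV := ℤ × ℤ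

/-- Embedding of corners into the plane: the square of index `z` is
`[z₁ - 1/2, z₁ + 1/2] × [z₂ - 1/2, z₂ + 1/2]`, so the origin is the centre of `S₀`. -/
noncomputable def toPlane (v : GridV) : ℝ × ℝ := ((v.1 : ℝ) - 1 / 2, (v.2 : ℝ) - 1 / 2)

/-- The closed unit square of index `z`. -/
def squareSet (z : GridV) : Set (ℝ × ℝ) :=
  Set.Icc ((z.1 : ℝ) - 1 / 2, (z.2 : ℝ) - 1 / 2) ((z.1 : ℝ) + 1 / 2, (z.2 : ℝ) + 1 / 2)

/-- The four edges (unit segments) of the square of index `z`, as unordered pairs of corners. -/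
def squareEdges (z : GridV) : Set (Sym2 GridV) :=
  {s(z, z + (1, 0)), s(z + (1, 0), z + (1, 1)), s(z + (1, 1), z + (0, 1)), s(z + (0, 1), z)}

/-- Adjacency of corners in the full grid graph `G`: Euclidean distance one. -/
def GridAdj (u v : GridV) : Prop := |u.1 - v.1| + |u.2 - v.2| = 1

/-- A cycle in the full grid graph: a cyclic sequence `(v₀, …, v_{n-1}, v₀)` of
distinct corners with consecutive corners adjacent. -/
structure GridCycle where
  n : ℕ
  hn : 3 ≤ n
  f : ZMod n → GridV
  inj : Function.Injective f
  adj : ∀ i, GridAdj (f i) (f (i + 1))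

/-- The edge set of a grid cycle. -/
def GridCycle.edgeSet (C : GridCycle) : Set (Sym2 GridV) :=
  {e | ∃ i : ZMod C.n, e = s(C.f i, C.f (i + 1))}

/-- An edge set is (the edge set of) a cycle of the grid graph `G`.
We identify a cycle with its edge set. -/
def IsCycle (E : Set (Sym2 GridV)) : Prop := ∃ C : GridCycle, C.edgeSet = E

/-- A cycle of the subgraph of the grid graph with edge set `G`. -/
def IsCycleIn (G E : Set (Sym2 GridV)) : Prop := IsCycle E ∧ E ⊆ G

/-- The vertices incident to some edge of `E`. -/
def vertexSetOf (E : Set (Sym2 GridV)) : Set GridV := {v | ∃ e ∈ E, v ∈ e}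

/-- The closed segment in the plane realizing an edge. -/
noncomputable def edgeSeg : Sym2 GridV → Set (ℝ × ℝ) :=
  Sym2.lift ⟨fun a b => segment ℝ (toPlane a) (toPlane b), fun _ _ => segment_symm ℝ _ _⟩

/-- The closed curve in the plane traced by the edges of `E`. -/
noncomputable def carrierOf (E : Set (Sym2 GridV)) : Set (ℝ × ℝ) := ⋃ e ∈ E, edgeSeg e

/-- The interior of a cycle: the union of the bounded connected components of the
complement of its carrier curve. -/
noncomputable def interiorOf (E : Set (Sym2 GridV)) : Set (ℝ × ℝ) :=
  {p | p ∉ carrierOf E ∧ Bornology.IsBounded (connectedComponentIn (carrierOf E)ᶜ p)}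

/-- The exterior of a cycle: the union of the unbounded connected components of the
complement of its carrier curve. -/
noncomputable def exteriorOf (E : Set (Sym2 GridV)) : Set (ℝ × ℝ) :=
  {p | p ∉ carrierOf E ∧ ¬ Bornology.IsBounded (connectedComponentIn (carrierOf E)ᶜ p)}

/-- The set `A` is contained in the interior of the cycle `E` (points of the
curve itself being allowed, so that e.g. a square whose boundary edges lie on the
cycle counts as contained in the interior). -/
def inInterior (E : Set (Sym2 GridV)) (A : Set (ℝ × ℝ)) : Prop :=
  A ⊆ interiorOf E ∪ carrierOf E

/-- The set `A` lies in the exterior of the cycle `E` (points of the curve itself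
being allowed). -/
def inExterior (E : Set (Sym2 GridV)) (A : Set (ℝ × ℝ)) : Prop :=
  A ⊆ exteriorOf E ∪ carrierOf E

/-- Star adjacency: distinct squares sharing at least a corner. -/
def starAdj (z w : GridV) : Prop := z ≠ w ∧ |z.1 - w.1| ≤ 1 ∧ |z.2 - w.2| ≤ 1

/-- Plus adjacency: squares sharing an edge. -/
def plusAdj (z w : GridV) : Prop := |z.1 - w.1| + |z.2 - w.2| = 1

/-- The star-connected occupied component `C(0)` of the square `S₀` (of index `(0,0)`),
for the occupancy configuration `ω`; empty if `S₀` is vacant. -/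
def starComp (ω : GridV → Prop) : Set GridV :=
  {z | ω z ∧ Relation.ReflTransGen (fun a b => ω a ∧ ω b ∧ starAdj a b) (0, 0) z}

/-- The plus-connected occupied component `C⁺(0)` of the square `S₀`. -/
def plusComp (ω : GridV → Prop) : Set GridV :=
  {z | ω z ∧ Relation.ReflTransGen (fun a b => ω a ∧ ω b ∧ plusAdj a b) (0, 0) z}

/-- The edge set of the graph `G_C`: all edges of squares of `C(0)`. -/
def gcEdges (ω : GridV → Prop) : Set (Sym2 GridV) := ⋃ z ∈ starComp ω, squareEdges z

/-- The edge set of the graph `G⁺_C`: all edges of squares of `C⁺(0)`. -/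
def gpcEdges (ω : GridV → Prop) : Set (Sym2 GridV) := ⋃ z ∈ plusComp ω, squareEdges z

/-- `e` is an outermost boundary edge of the graph with edge set `G`: for every
cycle `E` in this graph, either `e` is an edge of `E` or `e` lies in the exterior of `E`. -/
def outermostBoundaryEdgeIn (G : Set (Sym2 GridV)) (e : Sym2 GridV) : Prop :=
  e ∈ G ∧ ∀ E, IsCycleIn G E → e ∈ E ∨ inExterior E (edgeSeg e)

/-- The subgraph spanned by the edge set `E` is connected: any two incident vertices
are joined by a walk using only edges of `E`. -/
def EdgeSetConnected (E : Set (Sym2 GridV)) : Prop :=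
  ∀ u v, u ∈ vertexSetOf E → v ∈ vertexSetOf E →
    ∃ p : List GridV, p.head? = some u ∧ p.getLast? = some v ∧
      List.Chain' (fun a b => s(a, b) ∈ E) p

/-- `D` is the outermost boundary cycle `D_k` of the square of index `z` of the star
component `C(0)`: (a) the square lies in the interior of `D`; (b) every edge of `D` is a
boundary edge adjacent to an occupied square of `C(0)` in the interior of `D` and to a
vacant square in the exterior of `D`; (c) every cycle of `G_C` containing the square in
its interior has all its edges on `D` or in the interior of `D`. -/
def isOutermostCycleOf (ω : GridV → Prop) (z : GridV) (D : Set (Sym2 GridV)) : Prop :=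
  IsCycleIn (gcEdges ω) D ∧
  inInterior D (squareSet z) ∧
  (∀ e ∈ D,
    (∃ w ∈ starComp ω, e ∈ squareEdges w ∧ inInterior D (squareSet w)) ∧
    (∃ w, ¬ ω w ∧ e ∈ squareEdges w ∧ inExterior D (squareSet w))) ∧
  (∀ C, IsCycleIn (gcEdges ω) C → inInterior C (squareSet z) →
    ∀ e ∈ C, e ∈ D ∨ inInterior D (edgeSeg e))

/-- The list of edges traversed by a walk given as a list of vertices. -/
def walkEdges (p : List GridV) : List (Sym2 GridV) :=
  List.zipWith (fun a b => s(a, b)) p p.tail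

/-! ### Edges of the grid and the squares at their two sides -/

/-- The horizontal edge whose left endpoint is `z`. -/
def hEdge (z : GridV) : Sym2 GridV := s(z, z + (1, 0))

/-- The vertical edge whose lower endpoint is `z`. -/
def vEdge (z : GridV) : Sym2 GridV := s(z, z + (0, 1))

theorem hEdge_inj {z w : GridV} : hEdge z = hEdge w ↔ z = w := by
  obtain ⟨a, b⟩ := z
  obtain ⟨c, d⟩ := w
  simp only [hEdge, Sym2.eq_iff, Prod.mk_add_mk, Prod.mk.injEq]
  omega

theorem vEdge_inj {z w : GridV} : vEdge z = vEdge w ↔ z = w := by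
  obtain ⟨a, b⟩ := z
  obtain ⟨c, d⟩ := w
  simp only [vEdge, Sym2.eq_iff, Prod.mk_add_mk, Prod.mk.injEq]
  omega

theorem hEdge_ne_vEdge (z w : GridV) : hEdge z ≠ vEdge w := by
  obtain ⟨a, b⟩ := z
  obtain ⟨c, d⟩ := w
  simp only [hEdge, vEdge, ne_eq, Sym2.eq_iff, Prod.mk_add_mk, Prod.mk.injEq]
  omega

theorem mem_squareEdges {e : Sym2 GridV} {z : GridV} :
    e ∈ squareEdges z ↔
      e = hEdge z ∨ e = vEdge (z + (1, 0)) ∨ e = hEdge (z + (0, 1)) ∨ e = vEdge z := by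
  obtain ⟨a, b⟩ := z
  simp [squareEdges, hEdge, vEdge, Sym2.eq_swap]

theorem hEdge_mem_squareEdges {z w : GridV} :
    hEdge z ∈ squareEdges w ↔ w = z ∨ w = z - (0, 1) := by
  simp only [mem_squareEdges, hEdge_inj, hEdge_ne_vEdge, false_or, or_false, eq_sub_iff_add_eq]
  grind

theorem vEdge_mem_squareEdges {z w : GridV} :
    vEdge z ∈ squareEdges w ↔ w = z ∨ w = z - (1, 0) := by
  simp only [mem_squareEdges, vEdge_inj, (hEdge_ne_vEdge _ _).symm, false_or,
    eq_sub_iff_add_eq]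
  grind

theorem exists_eq_hEdge_or_vEdge {e : Sym2 GridV} {z : GridV} (h : e ∈ squareEdges z) :
    ∃ w, e = hEdge w ∨ e = vEdge w := by
  rcases mem_squareEdges.1 h with h | h | h | h
  exacts [⟨_, .inl h⟩, ⟨_, .inr h⟩, ⟨_, .inl h⟩, ⟨_, .inr h⟩]

/-- Every edge of a square lies on exactly two squares. -/
theorem exists_sides {e : Sym2 GridV} {z : GridV} (h : e ∈ squareEdges z) :
    ∃ w, w ≠ z ∧ starAdj z w ∧ ∀ c, e ∈ squareEdges c ↔ c = z ∨ c = w := by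
  obtain ⟨v, rfl | rfl⟩ := exists_eq_hEdge_or_vEdge h
  · rw [hEdge_mem_squareEdges] at h
    simp only [hEdge_mem_squareEdges]
    obtain ⟨x, y⟩ := v
    rcases h with rfl | rfl
    · exact ⟨(x, y) - (0, 1), by simp, by simp [starAdj]; omega, fun c => Iff.rfl⟩
    · exact ⟨(x, y), by simp; omega, by simp [starAdj], fun c => or_comm⟩
  · rw [vEdge_mem_squareEdges] at h
    simp only [vEdge_mem_squareEdges]
    obtain ⟨x, y⟩ := v
    rcases h with rfl | rfl
    · exact ⟨(x, y) - (1, 0), by simp, by simp [starAdj]; omega, fun c => Iff.rfl⟩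
    · exact ⟨(x, y), by simp; omega, by simp [starAdj], fun c => or_comm⟩

theorem gridAdj_iff {u v : GridV} :
    GridAdj u v ↔ v = u + (1, 0) ∨ u = v + (1, 0) ∨ v = u + (0, 1) ∨ u = v + (0, 1) := by
  obtain ⟨a, b⟩ := u
  obtain ⟨c, d⟩ := v
  simp only [GridAdj, Prod.mk_add_mk, Prod.mk.injEq]
  rcases abs_cases (a - c) with h | h <;> rcases abs_cases (b - d) with h' | h' <;> omega

theorem GridAdj.eq_hEdge_or_vEdge {u v : GridV} (h : GridAdj u v) :
    ∃ w, s(u, v) = hEdge w ∨ s(u, v) = vEdge w := by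
  rcases gridAdj_iff.1 h with rfl | rfl | rfl | rfl
  exacts [⟨_, .inl rfl⟩, ⟨_, .inl Sym2.eq_swap⟩, ⟨_, .inr rfl⟩, ⟨_, .inr Sym2.eq_swap⟩]

/-! ### The boundary of a set of squares -/

/-- The edges separating a square of `A` from a square outside `A`. -/
def edgeBoundary (A : Set GridV) : Set (Sym2 GridV) :=
  {e | ∃ a ∈ A, ∃ b ∉ A, e ∈ squareEdges a ∧ e ∈ squareEdges b}

theorem hEdge_mem_edgeBoundary {A : Set GridV} {z : GridV} :
    hEdge z ∈ edgeBoundary A ↔ ¬ (z ∈ A ↔ z - (0, 1) ∈ A) := by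
  simp only [edgeBoundary, Set.mem_ofPred_eq, hEdge_mem_squareEdges]
  grind

theorem vEdge_mem_edgeBoundary {A : Set GridV} {z : GridV} :
    vEdge z ∈ edgeBoundary A ↔ ¬ (z ∈ A ↔ z - (1, 0) ∈ A) := by
  simp only [edgeBoundary, Set.mem_ofPred_eq, vEdge_mem_squareEdges]
  grind

theorem mem_of_notMem_edgeBoundary {A : Set GridV} {e : Sym2 GridV} {a b : GridV}
    (he : e ∉ edgeBoundary A) (ha : e ∈ squareEdges a) (hb : e ∈ squareEdges b) (haA : a ∈ A) :
    b ∈ A :=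
  by_contra fun hbA => he ⟨a, haA, b, hbA, ha, hb⟩

theorem notMem_edgeBoundary {A : Set GridV} {e : Sym2 GridV} {a b : GridV} (hab : a ≠ b)
    (ha : e ∈ squareEdges a) (hb : e ∈ squareEdges b) (h : a ∈ A ↔ b ∈ A) :
    e ∉ edgeBoundary A := by
  obtain ⟨w, hw, -, hs⟩ := exists_sides ha
  rintro ⟨c, hc, d, hd, hec, hed⟩
  rw [hs] at hb hec hed
  grind

theorem edgeBoundary_empty : edgeBoundary ∅ = ∅ := by
  simp [edgeBoundary]

theorem edgeBoundary_union_subset (A B : Set GridV) :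
    edgeBoundary (A ∪ B) ⊆ edgeBoundary A ∪ edgeBoundary B := by
  rintro e ⟨a, ha | ha, b, hb, hea, heb⟩
  · exact .inl ⟨a, ha, b, fun h => hb (.inl h), hea, heb⟩
  · exact .inr ⟨a, ha, b, fun h => hb (.inr h), hea, heb⟩

theorem edgeBoundary_inter_subset (A B : Set GridV) :
    edgeBoundary (A ∩ B) ⊆ edgeBoundary A ∪ edgeBoundary B := by
  rintro e ⟨a, ha, b, hb, hea, heb⟩
  by_cases h : b ∈ A
  · exact .inr ⟨a, ha.2, b, fun h' => hb ⟨h, h'⟩, hea, heb⟩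
  · exact .inl ⟨a, ha.1, b, h, hea, heb⟩

theorem edgeBoundary_singleton_subset (z : GridV) : edgeBoundary {z} ⊆ squareEdges z := by
  rintro e ⟨a, rfl, b, -, h, -⟩
  exact h

/-- Crossing an edge changes the membership in two sets with the same boundary simultaneously. -/
theorem mem_iff_mem_of_edgeBoundary_eq {A B : Set GridV} (h : edgeBoundary A = edgeBoundary B)
    {e : Sym2 GridV} {a b : GridV} (ha : e ∈ squareEdges a) (hb : e ∈ squareEdges b) :
    (a ∈ A ↔ a ∈ B) ↔ (b ∈ A ↔ b ∈ B) := by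
  by_cases hab : a = b
  · rw [hab]
  by_cases he : e ∈ edgeBoundary A
  · have h1 : ¬ (a ∈ A ↔ b ∈ A) := fun h' => notMem_edgeBoundary hab ha hb h' he
    have h2 : ¬ (a ∈ B ↔ b ∈ B) := fun h' => notMem_edgeBoundary hab ha hb h' (h ▸ he)
    tauto
  · have he' : e ∉ edgeBoundary B := h ▸ he
    have h1 := mem_of_notMem_edgeBoundary he ha hb
    have h2 := mem_of_notMem_edgeBoundary he hb ha
    have h3 := mem_of_notMem_edgeBoundary he' ha hb
    have h4 := mem_of_notMem_edgeBoundary he' hb ha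
    tauto

theorem mem_iff_mem_add_of_edgeBoundary_eq {A B : Set GridV}
    (h : edgeBoundary A = edgeBoundary B) (z : GridV) (n : ℕ) :
    (z ∈ A ↔ z ∈ B) ↔ (z + ((n : ℤ), 0) ∈ A ↔ z + ((n : ℤ), 0) ∈ B) := by
  induction n with
  | zero => simp [← Prod.zero_eq_mk]
  | succ n ih =>
    rw [ih]
    refine mem_iff_mem_of_edgeBoundary_eq h (e := vEdge (z + (((n + 1 : ℕ) : ℤ), 0)))
      (vEdge_mem_squareEdges.2 (.inr ?_)) (vEdge_mem_squareEdges.2 (.inl rfl))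
    ext
    · simp
      ring
    · simp

theorem exists_right_notMem {A : Set GridV} (hA : A.Finite) (z : GridV) :
    ∃ n : ℕ, ∀ m : ℕ, n ≤ m → z + ((m : ℤ), 0) ∉ A := by
  obtain ⟨M, hM⟩ := (hA.image Prod.fst).bddAbove
  refine ⟨(M - z.1 + 1).toNat, fun m hm hmem => ?_⟩
  have := hM (Set.mem_image_of_mem _ hmem)
  simp only [Prod.fst_add] at this
  omega

theorem edgeBoundary_injOn_finite {A B : Set GridV} (hA : A.Finite) (hB : B.Finite)
    (h : edgeBoundary A = edgeBoundary B) : A = B := by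
  ext z
  obtain ⟨n, hn⟩ := exists_right_notMem (hA.union hB) z
  have := hn n le_rfl
  rw [mem_iff_mem_add_of_edgeBoundary_eq h z n]
  simp only [Set.mem_union] at this
  tauto

theorem edgeBoundary_nonempty {A : Set GridV} (hA : A.Finite) (hne : A.Nonempty) :
    (edgeBoundary A).Nonempty := by
  rw [Set.nonempty_iff_ne_empty] at hne ⊢
  exact fun h => hne (edgeBoundary_injOn_finite hA Set.finite_empty
    (h.trans edgeBoundary_empty.symm))

theorem squareEdges_finite (z : GridV) : (squareEdges z).Finite := by
  simp [squareEdges]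

theorem edgeBoundary_finite {A : Set GridV} (hA : A.Finite) : (edgeBoundary A).Finite := by
  refine (hA.biUnion fun z _ => squareEdges_finite z).subset ?_
  rintro e ⟨a, ha, -, -, h, -⟩
  exact Set.mem_biUnion ha h

theorem gridAdj_of_mem_edgeBoundary {A : Set GridV} {u v : GridV}
    (h : s(u, v) ∈ edgeBoundary A) : GridAdj u v := by
  obtain ⟨a, -, -, -, h, -⟩ := h
  rw [gridAdj_iff]
  obtain ⟨w, h | h⟩ := exists_eq_hEdge_or_vEdge h
  · rcases Sym2.eq_iff.1 h with ⟨rfl, rfl⟩ | ⟨rfl, rfl⟩ <;> simp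
  · rcases Sym2.eq_iff.1 h with ⟨rfl, rfl⟩ | ⟨rfl, rfl⟩ <;> simp

/-- Boundaries have no vertices of degree one. -/
theorem exists_ne_mem_edgeBoundary {A : Set GridV} {p u : GridV}
    (h : s(p, u) ∈ edgeBoundary A) : ∃ w ≠ u, s(p, w) ∈ edgeBoundary A := by
  have hadj := gridAdj_iff.1 (gridAdj_of_mem_edgeBoundary h)
  have h1 : s(p, p + (1, 0)) ∈ edgeBoundary A ↔ ¬ (p ∈ A ↔ p - (0, 1) ∈ A) :=
    hEdge_mem_edgeBoundary
  have h2 : s(p, p - (1, 0)) ∈ edgeBoundary A ↔ ¬ (p - (1, 0) ∈ A ↔ p - (1, 1) ∈ A) := by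
    have := hEdge_mem_edgeBoundary (A := A) (z := p - (1, 0))
    rwa [hEdge, Sym2.eq_swap, sub_add_cancel, sub_sub, Prod.mk_add_mk, add_zero, zero_add] at this
  have h3 : s(p, p + (0, 1)) ∈ edgeBoundary A ↔ ¬ (p ∈ A ↔ p - (1, 0) ∈ A) :=
    vEdge_mem_edgeBoundary
  have h4 : s(p, p - (0, 1)) ∈ edgeBoundary A ↔ ¬ (p - (0, 1) ∈ A ↔ p - (1, 1) ∈ A) := by
    have := vEdge_mem_edgeBoundary (A := A) (z := p - (0, 1))
    rwa [vEdge, Sym2.eq_swap, sub_add_cancel, sub_sub, Prod.mk_add_mk, add_zero, zero_add] at this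
  have h12 : p + (1, 0) ≠ p - (1, 0) := by simp [Prod.ext_iff]; omega
  have h13 : p + (1, 0) ≠ p + (0, 1) := by simp
  have h14 : p + (1, 0) ≠ p - (0, 1) := by simp [Prod.ext_iff]
  have h23 : p - (1, 0) ≠ p + (0, 1) := by simp [Prod.ext_iff]
  have h24 : p - (1, 0) ≠ p - (0, 1) := by simp
  have h34 : p + (0, 1) ≠ p - (0, 1) := by simp [Prod.ext_iff]; omega
  by_contra! hw
  have k1 := hw (p + (1, 0))
  have k2 := hw (p - (1, 0))
  have k3 := hw (p + (0, 1))
  have k4 := hw (p - (0, 1))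
  simp only [← sub_eq_iff_eq_add] at hadj
  rcases hadj with rfl | rfl | rfl | rfl <;> grind

/-! ### Cycles and boundaries -/

theorem GridCycle.neZero (C : GridCycle) : NeZero C.n := ⟨by have := C.hn; omega⟩

theorem GridCycle.edge_injective (C : GridCycle) :
    Function.Injective fun i => s(C.f i, C.f (i + 1)) := by
  intro i j hij
  rcases Sym2.eq_iff.1 hij with ⟨h, -⟩ | ⟨h1, h2⟩
  · exact C.inj h
  · have h1 := C.inj h1
    have h2 := C.inj h2
    have h3 : ((2 : ℕ) : ZMod C.n) = 0 := by
      push_cast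
      linear_combination h2 - h1
    rw [ZMod.natCast_eq_zero_iff] at h3
    have := Nat.le_of_dvd two_pos h3
    have := C.hn
    omega

/-- A nonempty boundary contained in a cycle is the whole cycle. -/
theorem IsCycle.edgeBoundary_eq_of_subset {E : Set (Sym2 GridV)} (hE : IsCycle E)
    {B : Set GridV} (hB : edgeBoundary B ⊆ E) (hne : (edgeBoundary B).Nonempty) :
    edgeBoundary B = E := by
  obtain ⟨C, rfl⟩ := hE
  have := C.neZero
  refine hB.antisymm ?_
  obtain ⟨e, he⟩ := hne
  obtain ⟨i, rfl⟩ := hB he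
  have step : ∀ j, s(C.f j, C.f (j + 1)) ∈ edgeBoundary B →
      s(C.f (j + 1), C.f (j + 1 + 1)) ∈ edgeBoundary B := by
    intro j hj
    rw [Sym2.eq_swap] at hj
    obtain ⟨w, hw, hmem⟩ := exists_ne_mem_edgeBoundary hj
    obtain ⟨k, hk⟩ := hB hmem
    rcases Sym2.eq_iff.1 hk with ⟨h1, h2⟩ | ⟨h1, h2⟩
    · rw [← C.inj h1] at h2
      rwa [← h2]
    · rw [← add_right_cancel (C.inj h1)] at h2
      exact absurd h2 hw
  have all : ∀ k : ℕ, s(C.f (i + k), C.f (i + k + 1)) ∈ edgeBoundary B := by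
    intro k
    induction k with
    | zero => simpa using he
    | succ k ih =>
      push_cast
      rw [← add_assoc]
      exact step _ ih
  rintro _ ⟨j, rfl⟩
  have := all (j - i).val
  rwa [ZMod.natCast_zmod_val, add_sub_cancel] at this

theorem IsCycle.nonempty {E : Set (Sym2 GridV)} (hE : IsCycle E) : E.Nonempty := by
  obtain ⟨C, rfl⟩ := hE
  exact ⟨_, 0, rfl⟩

/-- A closed walk without repetitions of length at least three is a cycle. -/
theorem exists_isCycle_of_closed_path {F : Set (Sym2 GridV)} (hF : ∀ u v, s(u, v) ∈ F → GridAdj u v)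
    (q : ℕ → GridV) (n : ℕ) (hn : 3 ≤ n) (hq : ∀ k, s(q k, q (k + 1)) ∈ F)
    (hinj : ∀ k < n, ∀ l < n, q k = q l → k = l) (hclose : q n = q 0) :
    ∃ E ⊆ F, IsCycle E := by
  have : NeZero n := ⟨by omega⟩
  have : Fact (1 < n) := ⟨by omega⟩
  have hsucc : ∀ i : ZMod n, q (i + 1).val = q (i.val + 1) := by
    intro i
    rw [ZMod.val_add, ZMod.val_one]
    have := ZMod.val_lt i
    rcases (show i.val + 1 < n ∨ i.val + 1 = n by omega) with h | h
    · rw [Nat.mod_eq_of_lt h]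
    · rw [h, Nat.mod_self, hclose]
  have hmem : ∀ i : ZMod n, s(q i.val, q (i + 1).val) ∈ F := fun i => by
    rw [hsucc]
    exact hq _
  let C : GridCycle :=
    { n := n
      hn := hn
      f := fun i => q i.val
      inj := fun i j h => ZMod.val_injective n (hinj _ (ZMod.val_lt i) _ (ZMod.val_lt j) h)
      adj := fun i => hF _ _ (hmem i) }
  refine ⟨C.edgeSet, ?_, C, rfl⟩
  rintro _ ⟨i, rfl⟩
  exact hmem i

/-- A finite nonempty set of edges without vertices of degree one contains a cycle. -/
theorem exists_isCycle_subset {F : Set (Sym2 GridV)} (hfin : F.Finite) (hne : F.Nonempty)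
    (hF : ∀ u v, s(u, v) ∈ F → GridAdj u v)
    (hdeg : ∀ p u, s(p, u) ∈ F → ∃ w ≠ u, s(p, w) ∈ F) :
    ∃ E ⊆ F, IsCycle E := by
  obtain ⟨e, he⟩ := hne
  induction e with | _ u₀ v₀
  choose! nxt hnxt hnxtF using hdeg
  let d : ℕ → GridV × GridV := fun k => (fun x => (x.2, nxt x.2 x.1))^[k] (u₀, v₀)
  have hd : ∀ k, d (k + 1) = ((d k).2, nxt (d k).2 (d k).1) := fun k =>
    Function.iterate_succ_apply' _ _ _
  have hdF : ∀ k, s((d k).1, (d k).2) ∈ F := by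
    intro k
    induction k with
    | zero => exact he
    | succ k ih =>
      rw [hd]
      exact hnxtF _ _ (by rwa [Sym2.eq_swap])
  let p : ℕ → GridV := fun k => (d k).1
  have hp1 : ∀ k, p (k + 1) = (d k).2 := fun k => by simp only [p, hd]
  have hpF : ∀ k, s(p k, p (k + 1)) ∈ F := fun k => by
    rw [hp1]
    exact hdF k
  have hp2 : ∀ k, p (k + 2) ≠ p k := fun k => by
    rw [hp1, hd]
    exact hnxt _ _ (by rw [Sym2.eq_swap]; exact hdF k)
  have hp0 : ∀ k, p (k + 1) ≠ p k := fun k h => by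
    have := hF _ _ (hpF k)
    rw [h] at this
    simp [GridAdj] at this
  have hVfin : (Set.range p).Finite := by
    refine (hfin.biUnion (t := fun e => {v | v ∈ e}) fun e _ => ?_).subset ?_
    · induction e with | _ a b
      simp only [Sym2.mem_iff]
      exact (Set.finite_singleton b).insert a
    · rintro _ ⟨k, rfl⟩
      exact Set.mem_biUnion (hpF k) (Sym2.mem_mk_left _ _)
  have hrep : ∃ n, ∃ i, 0 < n ∧ p (i + n) = p i := by
    have : ¬ Function.Injective p := fun h =>
      Set.infinite_range_of_injective h hVfin
    simp only [Function.Injective, not_forall] at this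
    obtain ⟨i, j, hij, hne⟩ := this
    rcases lt_or_gt_of_ne hne with h | h
    · exact ⟨j - i, i, by omega, by rw [Nat.add_sub_cancel' h.le, hij]⟩
    · exact ⟨i - j, j, by omega, by rw [Nat.add_sub_cancel' h.le, hij]⟩
  classical
  obtain ⟨i, hpos, hi⟩ := Nat.find_spec hrep
  set n := Nat.find hrep with hn
  have hmin : ∀ k l, k < l → l < n → p (i + k) ≠ p (i + l) := by
    intro k l hkl hl h
    have := Nat.find_min hrep (m := l - k) (by omega)
    exact this ⟨i + k, by omega, by rw [h]; congr 1; omega⟩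
  refine exists_isCycle_of_closed_path hF (fun k => p (i + k)) n ?_ (fun k => hpF _) ?_ hi
  · by_contra hlt
    have hcases : n = 1 ∨ n = 2 := by omega
    rcases hcases with h | h
    · exact hp0 i (h ▸ hi)
    · exact hp2 i (h ▸ hi)
  · intro k hk l hl h
    rcases lt_trichotomy k l with hlt | heq | hgt
    · exact absurd h (hmin k l hlt hl)
    · exact heq
    · exact absurd h.symm (hmin l k hgt hk)

theorem exists_isCycle_subset_edgeBoundary {A : Set GridV} (hA : A.Finite) (hne : A.Nonempty) :
    ∃ E ⊆ edgeBoundary A, IsCycle E :=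
  exists_isCycle_subset (edgeBoundary_finite hA) (edgeBoundary_nonempty hA hne)
    (fun _ _ => gridAdj_of_mem_edgeBoundary) fun _ _ => exists_ne_mem_edgeBoundary

/-! ### Every cycle bounds a finite set of squares -/

/-- Contribution of the edge `{u, v}` to the number of crossings (modulo two) of the downward
ray from the centre of the square `z`. -/
def crossing (z u v : GridV) : ZMod 2 :=
  ((if u.1 ≤ z.1 then 1 else 0) + (if v.1 ≤ z.1 then 1 else 0)) * (if u.2 ≤ z.2 then 1 else 0)

theorem ite_le_add_ite_le_sub_one (a x : ℤ) :
    (if a ≤ x then (1 : ZMod 2) else 0) + (if a ≤ x - 1 then 1 else 0) =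
      if a = x then 1 else 0 := by
  split_ifs <;> first | omega | decide

theorem crossing_add_below {z u v : GridV} (h : GridAdj u v) :
    crossing z u v + crossing (z - (0, 1)) u v = if s(u, v) = hEdge z then 1 else 0 := by
  have h2 : (1 : ZMod 2) + 1 = 0 := by decide
  obtain ⟨a, b⟩ := u
  obtain ⟨c, d⟩ := v
  obtain ⟨x, y⟩ := z
  have key := ite_le_add_ite_le_sub_one b y
  simp only [gridAdj_iff, Prod.mk_add_mk, Prod.mk.injEq] at h
  simp only [crossing, hEdge, Sym2.eq_iff, Prod.mk_add_mk, Prod.mk_sub_mk, Prod.mk.injEq, sub_zero,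
    add_zero]
  rw [← mul_add, key]
  rcases h with ⟨rfl, rfl⟩ | ⟨rfl, rfl⟩ | ⟨rfl, rfl⟩ | ⟨rfl, rfl⟩ <;>
    split_ifs <;> first | omega | simp [h2]

theorem crossing_add_left {z u v : GridV} (h : GridAdj u v) :
    crossing z u v + crossing (z - (1, 0)) u v =
      (if s(u, v) = vEdge z then 1 else 0) +
        ((if u.1 = z.1 ∧ u.2 ≤ z.2 then 1 else 0) + (if v.1 = z.1 ∧ v.2 ≤ z.2 then 1 else 0)) := by
  have h2 : (1 : ZMod 2) + 1 = 0 := by decide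
  obtain ⟨a, b⟩ := u
  obtain ⟨c, d⟩ := v
  obtain ⟨x, y⟩ := z
  have keya := ite_le_add_ite_le_sub_one a x
  have keyc := ite_le_add_ite_le_sub_one c x
  simp only [gridAdj_iff, Prod.mk_add_mk, Prod.mk.injEq] at h
  simp only [crossing, vEdge, Sym2.eq_iff, Prod.mk_add_mk, Prod.mk_sub_mk, Prod.mk.injEq, sub_zero,
    add_zero]
  rw [← add_mul, add_add_add_comm, keya, keyc]
  rcases h with ⟨rfl, rfl⟩ | ⟨rfl, rfl⟩ | ⟨rfl, rfl⟩ | ⟨rfl, rfl⟩ <;>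
    split_ifs <;> first | omega | simp [h2]

open Classical in
theorem IsCycle.exists_eq_edgeBoundary {E : Set (Sym2 GridV)} (hE : IsCycle E) :
    ∃ A : Set GridV, A.Finite ∧ edgeBoundary A = E := by
  obtain ⟨C, rfl⟩ := hE
  have := C.neZero
  have hchar : ∀ x : ZMod 2, x + x = 0 := by decide
  have hxor : ∀ x y : ZMod 2, ¬ (x = 1 ↔ y = 1) ↔ x + y = 1 := by decide
  have hshift : ∀ g : GridV → ZMod 2, ∑ i, g (C.f (i + 1)) = ∑ i, g (C.f i) := fun g =>
    Equiv.sum_comp (Equiv.addRight (1 : ZMod C.n)) fun i => g (C.f i)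
  let a : GridV → ZMod 2 := fun z => ∑ i, crossing z (C.f i) (C.f (i + 1))
  have hcount : ∀ e, ∑ i, (if s(C.f i, C.f (i + 1)) = e then (1 : ZMod 2) else 0) =
      if e ∈ C.edgeSet then 1 else 0 := by
    intro e
    split_ifs with he
    · obtain ⟨j, rfl⟩ := he
      simp only [C.edge_injective.eq_iff]
      simp
    · exact Finset.sum_eq_zero fun i _ => if_neg fun h => he ⟨i, h.symm⟩
  have hh : ∀ z, a z + a (z - (0, 1)) = if hEdge z ∈ C.edgeSet then 1 else 0 := by
    intro z
    rw [← hcount, ← Finset.sum_add_distrib]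
    exact Finset.sum_congr rfl fun i _ => crossing_add_below (C.adj i)
  have hv : ∀ z, a z + a (z - (1, 0)) = if vEdge z ∈ C.edgeSet then 1 else 0 := by
    intro z
    rw [← hcount, ← Finset.sum_add_distrib,
      Finset.sum_congr rfl fun i _ => crossing_add_left (C.adj i), Finset.sum_add_distrib,
      Finset.sum_add_distrib,
      hshift fun v => if v.1 = z.1 ∧ v.2 ≤ z.2 then 1 else 0, hchar, add_zero]
  obtain ⟨⟨M₁, M₂⟩, hM⟩ := (Set.finite_range C.f).bddAbove
  obtain ⟨⟨m₁, m₂⟩, hm⟩ := (Set.finite_range C.f).bddBelow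
  have hM : ∀ i, (C.f i).1 ≤ M₁ ∧ (C.f i).2 ≤ M₂ := fun i => hM ⟨i, rfl⟩
  have hm : ∀ i, m₁ ≤ (C.f i).1 ∧ m₂ ≤ (C.f i).2 := fun i => hm ⟨i, rfl⟩
  refine ⟨{z | a z = 1}, (Set.finite_Icc (m₁, m₂) (M₁, M₂)).subset fun z hz => ?_, ?_⟩
  · by_contra hout
    have hz0 : a z = 0 := by
      rw [Set.mem_Icc, Prod.le_def, Prod.le_def] at hout
      rcases (show z.1 < m₁ ∨ M₁ ≤ z.1 ∨ z.2 < m₂ ∨ M₂ ≤ z.2 by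
        simp only at hout; omega) with h | h | h | h
      · refine Finset.sum_eq_zero fun i _ => ?_
        have := hm i
        have := hm (i + 1)
        rw [crossing, if_neg (by omega), if_neg (by omega), add_zero, zero_mul]
      · refine Finset.sum_eq_zero fun i _ => ?_
        have := hM i
        have := hM (i + 1)
        rw [crossing, if_pos (by omega), if_pos (by omega), hchar, zero_mul]
      · refine Finset.sum_eq_zero fun i _ => ?_
        have := hm i
        rw [crossing, if_neg (by omega : ¬ (C.f i).2 ≤ z.2), mul_zero]
      · have : ∀ i, crossing z (C.f i) (C.f (i + 1)) =
            (if (C.f i).1 ≤ z.1 then 1 else 0) + (if (C.f (i + 1)).1 ≤ z.1 then 1 else 0) := by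
          intro i
          have := hM i
          rw [crossing, if_pos (by omega : (C.f i).2 ≤ z.2), mul_one]
        simp only [a, this]
        rw [Finset.sum_add_distrib, hshift fun v => if v.1 ≤ z.1 then 1 else 0, hchar]
    exact zero_ne_one (hz0.symm.trans hz)
  · have key : ∀ w, (hEdge w ∈ edgeBoundary {z | a z = 1} ↔ hEdge w ∈ C.edgeSet) ∧
        (vEdge w ∈ edgeBoundary {z | a z = 1} ↔ vEdge w ∈ C.edgeSet) := by
      intro w
      rw [hEdge_mem_edgeBoundary, vEdge_mem_edgeBoundary]
      simp only [Set.mem_ofPred_eq, hxor, hh, hv]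
      simp
    ext e
    constructor
    · intro he
      obtain ⟨z, -, -, -, hz, -⟩ := id he
      obtain ⟨w, rfl | rfl⟩ := exists_eq_hEdge_or_vEdge hz
      exacts [(key w).1.1 he, (key w).2.1 he]
    · intro he
      obtain ⟨i, hi⟩ := id he
      obtain ⟨w, hw | hw⟩ := (C.adj i).eq_hEdge_or_vEdge
      · rw [hi, hw] at he ⊢
        exact (key w).1.2 he
      · rw [hi, hw] at he ⊢
        exact (key w).2.2 he

/-! ### Connected sets of squares and their outer boundary cycle -/

/-- A set of squares is indecomposable if it has no proper nonempty subset whose boundary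
consists of boundary edges of the whole set, i.e. if it is plus-connected. -/
def Indecomposable (X : Set GridV) : Prop :=
  ∀ B ⊆ X, B.Nonempty → edgeBoundary B ⊆ edgeBoundary X → B = X

theorem indecomposable_singleton (z : GridV) : Indecomposable {z} :=
  fun _ hB hne _ => hne.subset_singleton_iff.1 hB

theorem indecomposable_of_isCycle {A : Set GridV} (hA : A.Finite)
    (hcyc : IsCycle (edgeBoundary A)) : Indecomposable A := fun _ hB hne hsub =>
  edgeBoundary_injOn_finite (hA.subset hB) hA
    (hcyc.edgeBoundary_eq_of_subset hsub (edgeBoundary_nonempty (hA.subset hB) hne))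

theorem edgeBoundary_inter_subset_of_union {A B X : Set GridV}
    (h : edgeBoundary B ⊆ edgeBoundary (A ∪ X)) : edgeBoundary (B ∩ A) ⊆ edgeBoundary A := by
  rintro e ⟨a, ha, b, hb, hea, heb⟩
  refine ⟨a, ha.2, b, fun hbA => ?_, hea, heb⟩
  have hbB : b ∉ B := fun hbB => hb ⟨hbB, hbA⟩
  have hab : a ≠ b := fun hab => hbB (hab ▸ ha.1)
  exact notMem_edgeBoundary hab hea heb (iff_of_true (.inl ha.2) (.inl hbA))
    (h ⟨a, ha.1, b, hbB, hea, heb⟩)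

/-- Two indecomposable sets which overlap or share an edge have indecomposable union. -/
theorem Indecomposable.union {X Y : Set GridV} (hX : Indecomposable X) (hY : Indecomposable Y)
    {e : Sym2 GridV} {a b : GridV} (ha : a ∈ X) (hb : b ∈ Y) (hea : e ∈ squareEdges a)
    (heb : e ∈ squareEdges b) : Indecomposable (X ∪ Y) := by
  intro B hB hne hsub
  have hBX : (B ∩ X).Nonempty → X ⊆ B := fun h => by
    have := hX _ Set.inter_subset_right h (edgeBoundary_inter_subset_of_union hsub)
    exact Set.inter_eq_right.1 this
  have hBY : (B ∩ Y).Nonempty → Y ⊆ B := fun h => by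
    have := hY _ Set.inter_subset_right h
      (edgeBoundary_inter_subset_of_union (by rwa [Set.union_comm] at hsub))
    exact Set.inter_eq_right.1 this
  have hab : a ∈ B ↔ b ∈ B := by
    by_cases h : a = b
    · rw [h]
    have : e ∉ edgeBoundary B := fun h' =>
      notMem_edgeBoundary h hea heb (iff_of_true (.inl ha) (.inr hb)) (hsub h')
    exact ⟨mem_of_notMem_edgeBoundary this hea heb, mem_of_notMem_edgeBoundary this heb hea⟩
  refine hB.antisymm (Set.union_subset_iff.2 ?_)
  obtain ⟨x, hx⟩ := hne
  rcases hB hx with h | h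
  · have := hBX ⟨x, hx, h⟩
    exact ⟨this, hBY ⟨b, hab.1 (this ha), hb⟩⟩
  · have := hBY ⟨x, hx, h⟩
    exact ⟨hBX ⟨a, hab.2 (this hb), ha⟩, this⟩

/-- There are finitely many finite sets of squares with boundary inside a given finite set. -/
theorem finite_setOf_edgeBoundary_subset {G : Set (Sym2 GridV)} (hG : G.Finite) :
    {A : Set GridV | A.Finite ∧ edgeBoundary A ⊆ G}.Finite := by
  refine Set.Finite.of_finite_image (f := edgeBoundary)
    (hG.finite_subsets.subset ?_) fun _ hA _ hB h => edgeBoundary_injOn_finite hA.1 hB.1 h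
  rintro _ ⟨A, hA, rfl⟩
  exact hA.2

/-- An indecomposable finite set of squares is enclosed by a cycle of boundary edges. -/
theorem Indecomposable.exists_isCycle {X : Set GridV} (hX : Indecomposable X) (hfin : X.Finite)
    (hne : X.Nonempty) :
    ∃ A, X ⊆ A ∧ A.Finite ∧ IsCycle (edgeBoundary A) ∧ edgeBoundary A ⊆ edgeBoundary X := by
  let S : Set (Set GridV) := {F | F.Finite ∧ X ⊆ F ∧ edgeBoundary F ⊆ edgeBoundary X}
  have hS : S.Finite := (finite_setOf_edgeBoundary_subset (edgeBoundary_finite hfin)).subset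
    fun F hF => ⟨hF.1, hF.2.2⟩
  obtain ⟨F, ⟨hFfin, hXF, hFX⟩, hmax⟩ := hS.exists_maximal ⟨X, hfin, subset_rfl, subset_rfl⟩
  obtain ⟨E, hEF, hE⟩ := exists_isCycle_subset_edgeBoundary hFfin (hne.mono hXF)
  obtain ⟨A, hA, rfl⟩ := hE.exists_eq_edgeBoundary
  have hAX := hEF.trans hFX
  have hAF : A ⊆ F := Set.subset_union_left.trans <| hmax
    ⟨hA.union hFfin, hXF.trans Set.subset_union_right,
      (edgeBoundary_union_subset A F).trans (Set.union_subset hAX hFX)⟩ Set.subset_union_right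
  have hint : (X ∩ A).Nonempty := by
    obtain ⟨e, he⟩ := hE.nonempty
    obtain ⟨a, ha, b, hb, hea, heb⟩ := id he
    have hab : a ≠ b := fun h => hb (h ▸ ha)
    have hbF : b ∉ F := fun h => notMem_edgeBoundary hab hea heb (iff_of_true (hAF ha) h) (hEF he)
    refine ⟨a, by_contra fun haX => ?_, ha⟩
    exact notMem_edgeBoundary hab hea heb (iff_of_false haX fun h => hbF (hXF h)) (hAX he)
  refine ⟨A, ?_, hA, hE, hAX⟩
  exact Set.inter_eq_left.1 (hX _ Set.inter_subset_left hint
    ((edgeBoundary_inter_subset X A).trans (Set.union_subset subset_rfl hAX)))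

/-! ### The curve traced by a boundary -/

/-- The centre of the square of index `z`. -/
def squareCenter (z : GridV) : ℝ × ℝ := (z.1, z.2)

theorem mem_squareSet {p : ℝ × ℝ} {z : GridV} :
    p ∈ squareSet z ↔ ((z.1 : ℝ) - 1 / 2 ≤ p.1 ∧ p.1 ≤ z.1 + 1 / 2) ∧
      ((z.2 : ℝ) - 1 / 2 ≤ p.2 ∧ p.2 ≤ z.2 + 1 / 2) := by
  rw [squareSet, Set.mem_Icc, Prod.le_def, Prod.le_def]
  tauto

theorem isClosed_squareSet (z : GridV) : IsClosed (squareSet z) := isClosed_Icc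

theorem squareCenter_mem (z : GridV) : squareCenter z ∈ squareSet z := by
  rw [mem_squareSet]
  simp only [squareCenter]
  constructor <;> constructor <;> linarith

theorem mem_edgeSeg_hEdge {p : ℝ × ℝ} {z : GridV} :
    p ∈ edgeSeg (hEdge z) ↔
      ((z.1 : ℝ) - 1 / 2 ≤ p.1 ∧ p.1 ≤ z.1 + 1 / 2) ∧ p.2 = z.2 - 1 / 2 := by
  obtain ⟨x, y⟩ := p
  have h : edgeSeg (hEdge z) =
      segment ℝ ((z.1 : ℝ) - 1 / 2, (z.2 : ℝ) - 1 / 2) ((z.1 : ℝ) + 1 / 2, (z.2 : ℝ) - 1 / 2) := by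
    have h1 : toPlane (z + (1, 0)) = ((z.1 : ℝ) + 1 / 2, (z.2 : ℝ) - 1 / 2) := by
      simp only [toPlane, Prod.fst_add, Prod.snd_add]
      push_cast
      ext <;> ring
    rw [← h1]
    rfl
  rw [h, ← Prod.image_mk_segment_left, segment_eq_Icc (by linarith)]
  simp only [Set.mem_image, Set.mem_Icc, Prod.mk.injEq]
  grind

theorem mem_edgeSeg_vEdge {p : ℝ × ℝ} {z : GridV} :
    p ∈ edgeSeg (vEdge z) ↔
      p.1 = z.1 - 1 / 2 ∧ ((z.2 : ℝ) - 1 / 2 ≤ p.2 ∧ p.2 ≤ z.2 + 1 / 2) := by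
  obtain ⟨x, y⟩ := p
  have h : edgeSeg (vEdge z) =
      segment ℝ ((z.1 : ℝ) - 1 / 2, (z.2 : ℝ) - 1 / 2) ((z.1 : ℝ) - 1 / 2, (z.2 : ℝ) + 1 / 2) := by
    have h1 : toPlane (z + (0, 1)) = ((z.1 : ℝ) - 1 / 2, (z.2 : ℝ) + 1 / 2) := by
      simp only [toPlane, Prod.fst_add, Prod.snd_add]
      push_cast
      ext <;> ring
    rw [← h1]
    rfl
  rw [h, ← Prod.image_mk_segment_right, segment_eq_Icc (by linarith)]
  simp only [Set.mem_image, Set.mem_Icc, Prod.mk.injEq]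
  grind

theorem edgeSeg_subset_squareSet {e : Sym2 GridV} {z : GridV} (h : e ∈ squareEdges z) :
    edgeSeg e ⊆ squareSet z := by
  intro p hp
  rw [mem_squareSet]
  rcases mem_squareEdges.1 h with rfl | rfl | rfl | rfl
  all_goals
    simp only [mem_edgeSeg_hEdge, mem_edgeSeg_vEdge, Prod.fst_add, Prod.snd_add, Int.cast_add,
      Int.cast_one, Int.cast_zero] at hp
    grind

/-- An integer at distance less than one from another one is equal to it. -/
theorem int_eq_of_abs_sub_lt_one {a b : ℤ} (h : |(a : ℝ) - b| < 1) : a = b := by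
  have h' : |a - b| < 1 := by exact_mod_cast h
  rw [Int.abs_lt_one_iff] at h'
  omega

theorem exists_mem_edgeSeg {e : Sym2 GridV} {z : GridV} (h : e ∈ squareEdges z) :
    ∃ m ∈ edgeSeg e, ∀ c, m ∈ squareSet c → e ∈ squareEdges c := by
  obtain ⟨w, rfl | rfl⟩ := exists_eq_hEdge_or_vEdge h
  · refine ⟨((w.1 : ℝ), (w.2 : ℝ) - 1 / 2), ?_, fun c hc => ?_⟩
    · rw [mem_edgeSeg_hEdge]
      grind
    · rw [mem_squareSet] at hc
      simp only at hc
      have h1 : c.1 = w.1 := int_eq_of_abs_sub_lt_one (by rw [abs_lt]; constructor <;> linarith)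
      have h2 : c.2 ≤ w.2 := by
        have : (c.2 : ℝ) ≤ w.2 := by linarith
        exact_mod_cast this
      have h3 : w.2 ≤ c.2 + 1 := by
        have : (w.2 : ℝ) ≤ c.2 + 1 := by linarith
        exact_mod_cast this
      rw [hEdge_mem_squareEdges, Prod.ext_iff, Prod.ext_iff, Prod.fst_sub, Prod.snd_sub]
      omega
  · refine ⟨((w.1 : ℝ) - 1 / 2, (w.2 : ℝ)), ?_, fun c hc => ?_⟩
    · rw [mem_edgeSeg_vEdge]
      grind
    · rw [mem_squareSet] at hc
      simp only at hc
      have h1 : c.2 = w.2 := int_eq_of_abs_sub_lt_one (by rw [abs_lt]; constructor <;> linarith)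
      have h2 : c.1 ≤ w.1 := by
        have : (c.1 : ℝ) ≤ w.1 := by linarith
        exact_mod_cast this
      have h3 : w.1 ≤ c.1 + 1 := by
        have : (w.1 : ℝ) ≤ c.1 + 1 := by linarith
        exact_mod_cast this
      rw [vEdge_mem_squareEdges, Prod.ext_iff, Prod.ext_iff, Prod.fst_sub, Prod.snd_sub]
      omega

theorem mem_carrierOf {E : Set (Sym2 GridV)} {p : ℝ × ℝ} :
    p ∈ carrierOf E ↔ ∃ e ∈ E, p ∈ edgeSeg e := by
  simp [carrierOf]

theorem mem_carrierOf_of_snd_lt {A : Set GridV} {a b : GridV} {p : ℝ × ℝ}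
    (hab : ¬ (a ∈ A ↔ b ∈ A)) (h1 : a.1 = b.1) (hpa : p ∈ squareSet a) (hpb : p ∈ squareSet b)
    (hlt : b.2 < a.2) : p ∈ carrierOf (edgeBoundary A) := by
  rw [mem_squareSet] at hpa hpb
  have h2 : a.2 ≤ b.2 + 1 := by
    have : (a.2 : ℝ) ≤ b.2 + 1 := by linarith
    exact_mod_cast this
  have h3 : a.2 = b.2 + 1 := by omega
  have hb : b = a - (0, 1) := by
    rw [Prod.ext_iff, Prod.fst_sub, Prod.snd_sub]
    omega
  have h3' : (a.2 : ℝ) = b.2 + 1 := by exact_mod_cast h3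
  exact mem_carrierOf.2 ⟨hEdge a, hEdge_mem_edgeBoundary.2 (hb ▸ hab),
    mem_edgeSeg_hEdge.2 ⟨hpa.1, by linarith⟩⟩

theorem mem_carrierOf_of_fst_lt {A : Set GridV} {a b : GridV} {p : ℝ × ℝ}
    (hab : ¬ (a ∈ A ↔ b ∈ A)) (h1 : a.2 = b.2) (hpa : p ∈ squareSet a) (hpb : p ∈ squareSet b)
    (hlt : b.1 < a.1) : p ∈ carrierOf (edgeBoundary A) := by
  rw [mem_squareSet] at hpa hpb
  have h2 : a.1 ≤ b.1 + 1 := by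
    have : (a.1 : ℝ) ≤ b.1 + 1 := by linarith
    exact_mod_cast this
  have h3 : a.1 = b.1 + 1 := by omega
  have hb : b = a - (1, 0) := by
    rw [Prod.ext_iff, Prod.fst_sub, Prod.snd_sub]
    omega
  have h3' : (a.1 : ℝ) = b.1 + 1 := by exact_mod_cast h3
  exact mem_carrierOf.2 ⟨vEdge a, vEdge_mem_edgeBoundary.2 (hb ▸ hab),
    mem_edgeSeg_vEdge.2 ⟨by linarith, hpa.2⟩⟩

/-- The curve traced by the boundary of `A` consists of the points lying both in a square of `A`
and in a square outside `A`. -/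
theorem mem_carrierOf_edgeBoundary {A : Set GridV} {p : ℝ × ℝ} :
    p ∈ carrierOf (edgeBoundary A) ↔ ∃ a ∈ A, ∃ b ∉ A, p ∈ squareSet a ∧ p ∈ squareSet b := by
  constructor
  · rw [mem_carrierOf]
    rintro ⟨e, ⟨a, ha, b, hb, hea, heb⟩, hp⟩
    exact ⟨a, ha, b, hb, edgeSeg_subset_squareSet hea hp, edgeSeg_subset_squareSet heb hp⟩
  · rintro ⟨a, ha, b, hb, hpa, hpb⟩
    have hpc : p ∈ squareSet (a.1, b.2) := by
      rw [mem_squareSet] at hpa hpb ⊢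
      exact ⟨hpa.1, hpb.2⟩
    by_cases hc : (a.1, b.2) ∈ A
    · have hbc : ¬ ((a.1, b.2) ∈ A ↔ b ∈ A) := by tauto
      rcases lt_trichotomy a.1 b.1 with h | h | h
      · exact mem_carrierOf_of_fst_lt (fun h => hbc h.symm) rfl hpb hpc h
      · exact absurd ((Prod.ext h rfl : (a.1, b.2) = b) ▸ hc) hb
      · exact mem_carrierOf_of_fst_lt hbc rfl hpc hpb h
    · have hac : ¬ ((a.1, b.2) ∈ A ↔ a ∈ A) := by tauto
      rcases lt_trichotomy a.2 b.2 with h | h | h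
      · exact mem_carrierOf_of_snd_lt hac rfl hpc hpa h
      · exact absurd ((Prod.ext rfl h : a = (a.1, b.2)) ▸ ha) hc
      · exact mem_carrierOf_of_snd_lt (fun h => hac h.symm) rfl hpa hpc h

theorem exists_mem_edgeSeg_notMem_carrierOf {A : Set GridV} {e : Sym2 GridV} {z : GridV}
    (hz : e ∈ squareEdges z) (he : e ∉ edgeBoundary A) :
    ∃ m ∈ edgeSeg e, m ∉ carrierOf (edgeBoundary A) := by
  obtain ⟨m, hm, hmc⟩ := exists_mem_edgeSeg hz
  refine ⟨m, hm, fun h => he ?_⟩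
  obtain ⟨a, ha, b, hb, hma, hmb⟩ := mem_carrierOf_edgeBoundary.1 h
  exact ⟨a, ha, b, hb, hmc a hma, hmc b hmb⟩

theorem eq_of_mem_squareSet_of_abs_lt {p : ℝ × ℝ} {z c : GridV} (h1 : |p.1 - z.1| < 1 / 2)
    (h2 : |p.2 - z.2| < 1 / 2) (hc : p ∈ squareSet c) : c = z := by
  rw [mem_squareSet] at hc
  rw [abs_lt] at h1 h2
  exact Prod.ext (int_eq_of_abs_sub_lt_one (by rw [abs_lt]; constructor <;> linarith))
    (int_eq_of_abs_sub_lt_one (by rw [abs_lt]; constructor <;> linarith))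

/-- A point of a square off the curve can be joined to the centre of the square. -/
theorem connectedComponentIn_eq_squareCenter {A : Set GridV} {p : ℝ × ℝ} {z : GridV}
    (hpz : p ∈ squareSet z) (hp : p ∉ carrierOf (edgeBoundary A)) :
    connectedComponentIn (carrierOf (edgeBoundary A))ᶜ p =
      connectedComponentIn (carrierOf (edgeBoundary A))ᶜ (squareCenter z) := by
  have hsub : segment ℝ (squareCenter z) p ⊆ (carrierOf (edgeBoundary A))ᶜ := by
    intro q hq hqA
    obtain ⟨t, ⟨ht0, ht1⟩, rfl⟩ := (segment_eq_image' ℝ _ _).subset hq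
    rcases ht1.lt_or_eq with ht | rfl
    · rw [mem_squareSet] at hpz
      have hz : ∀ c, squareCenter z + t • (p - squareCenter z) ∈ squareSet c → c = z := by
        intro c hc
        refine eq_of_mem_squareSet_of_abs_lt ?_ ?_ hc
        all_goals
          simp only [squareCenter, Prod.fst_add, Prod.snd_add, Prod.smul_fst, Prod.smul_snd,
            Prod.fst_sub, Prod.snd_sub, smul_eq_mul, add_sub_cancel_left]
          rw [abs_mul, abs_of_nonneg ht0]
        · have : |p.1 - z.1| ≤ 1 / 2 := abs_le.2 ⟨by linarith, by linarith⟩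
          nlinarith
        · have : |p.2 - z.2| ≤ 1 / 2 := abs_le.2 ⟨by linarith, by linarith⟩
          nlinarith
      obtain ⟨a, ha, b, hb, hqa, hqb⟩ := mem_carrierOf_edgeBoundary.1 hqA
      exact hb (hz b hqb ▸ hz a hqa ▸ ha)
    · simp only [one_smul, add_sub_cancel] at hqA
      exact hp hqA
  exact connectedComponentIn_eq ((convex_segment _ _).isPreconnected.subset_connectedComponentIn
    (right_mem_segment ℝ _ _) hsub (left_mem_segment ℝ _ _))

theorem squareCenter_notMem_carrierOf (A : Set GridV) (z : GridV) :
    squareCenter z ∉ carrierOf (edgeBoundary A) := by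
  intro h
  obtain ⟨a, ha, b, hb, hqa, hqb⟩ := mem_carrierOf_edgeBoundary.1 h
  have hz : ∀ c, squareCenter z ∈ squareSet c → c = z := fun c hc =>
    eq_of_mem_squareSet_of_abs_lt (by simp [squareCenter]) (by simp [squareCenter]) hc
  exact hb (hz b hqb ▸ hz a hqa ▸ ha)

theorem connectedComponentIn_squareCenter_eq {A : Set GridV} {e : Sym2 GridV} {a b : GridV}
    (he : e ∉ edgeBoundary A) (ha : e ∈ squareEdges a) (hb : e ∈ squareEdges b) :
    connectedComponentIn (carrierOf (edgeBoundary A))ᶜ (squareCenter a) =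
      connectedComponentIn (carrierOf (edgeBoundary A))ᶜ (squareCenter b) := by
  obtain ⟨m, hm, hmA⟩ := exists_mem_edgeSeg_notMem_carrierOf ha he
  rw [← connectedComponentIn_eq_squareCenter (edgeSeg_subset_squareSet ha hm) hmA,
    connectedComponentIn_eq_squareCenter (edgeSeg_subset_squareSet hb hm) hmA]

theorem locallyFinite_squareSet : LocallyFinite squareSet := by
  intro p
  refine ⟨Metric.ball p 1, Metric.ball_mem_nhds p one_pos, (Set.finite_Icc
    ((⌊p.1⌋ - 2, ⌊p.2⌋ - 2) : GridV) (⌈p.1⌉ + 2, ⌈p.2⌉ + 2)).subset ?_⟩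
  rintro z ⟨q, hq, hqp⟩
  rw [mem_squareSet] at hq
  rw [Metric.mem_ball, Prod.dist_eq, max_lt_iff, Real.dist_eq, Real.dist_eq, abs_lt, abs_lt] at hqp
  have h1 := Int.floor_le p.1
  have h2 := Int.floor_le p.2
  have h3 := Int.le_ceil p.1
  have h4 := Int.le_ceil p.2
  rw [Set.mem_Icc, Prod.le_def, Prod.le_def]
  refine ⟨⟨?_, ?_⟩, ?_, ?_⟩
  all_goals
    simp only
    rw [← Int.cast_le (R := ℝ)]
    push_cast
    linarith

theorem isClosed_biUnion_squareSet (A : Set GridV) : IsClosed (⋃ z ∈ A, squareSet z) := by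
  rw [Set.biUnion_eq_iUnion]
  exact (locallyFinite_squareSet.comp_injective Subtype.val_injective).isClosed_iUnion
    fun z => isClosed_squareSet _

theorem exists_mem_squareSet (p : ℝ × ℝ) : ∃ z, p ∈ squareSet z := by
  refine ⟨(round p.1, round p.2), mem_squareSet.2 ?_⟩
  have h1 := abs_le.1 (abs_sub_round p.1)
  have h2 := abs_le.1 (abs_sub_round p.2)
  simp only
  constructor <;> constructor <;> linarith

/-! ### Interior and exterior of the boundary of a set of squares -/

theorem isBounded_connectedComponentIn_squareCenter {A : Set GridV} (hA : A.Finite) {z : GridV}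
    (hz : z ∈ A) : Bornology.IsBounded
      (connectedComponentIn (carrierOf (edgeBoundary A))ᶜ (squareCenter z)) := by
  have hK : IsCompact (⋃ z ∈ A, squareSet z) := hA.isCompact_biUnion fun z _ => isCompact_Icc
  refine hK.isBounded.subset fun q hq => by_contra fun hqK => ?_
  obtain ⟨w, hw⟩ := exists_mem_squareSet q
  have hwA : w ∉ A := fun h => hqK (Set.mem_biUnion h hw)
  obtain ⟨x, hx, hxA, hxA'⟩ := isPreconnected_closed_iff.1
    (isPreconnected_connectedComponentIn (x := squareCenter z)
      (F := (carrierOf (edgeBoundary A))ᶜ)) _ _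
    (isClosed_biUnion_squareSet A) (isClosed_biUnion_squareSet Aᶜ)
    (fun x _ => by
      obtain ⟨c, hc⟩ := exists_mem_squareSet x
      by_cases h : c ∈ A
      exacts [.inl (Set.mem_biUnion h hc), .inr (Set.mem_biUnion h hc)])
    ⟨_, mem_connectedComponentIn (squareCenter_notMem_carrierOf A z),
      Set.mem_biUnion hz (squareCenter_mem z)⟩
    ⟨q, hq, Set.mem_biUnion (show w ∈ Aᶜ from hwA) hw⟩
  obtain ⟨a, ha, hxa⟩ := Set.mem_iUnion₂.1 hxA
  obtain ⟨b, hb, hxb⟩ := Set.mem_iUnion₂.1 hxA'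
  exact connectedComponentIn_subset _ _ hx (mem_carrierOf_edgeBoundary.2 ⟨a, ha, b, hb, hxa, hxb⟩)

theorem not_isBounded_of_forall_right_notMem {A : Set GridV} {z : GridV}
    (h : ∀ n : ℕ, z + ((n : ℤ), 0) ∉ A) : ¬ Bornology.IsBounded
      (connectedComponentIn (carrierOf (edgeBoundary A))ᶜ (squareCenter z)) := by
  have hcomp : ∀ n : ℕ, connectedComponentIn (carrierOf (edgeBoundary A))ᶜ (squareCenter z) =
      connectedComponentIn (carrierOf (edgeBoundary A))ᶜ (squareCenter (z + ((n : ℤ), 0))) := by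
    intro n
    induction n with
    | zero => simp [← Prod.zero_eq_mk]
    | succ n ih =>
      have hsub : z + ((n : ℤ), 0) = z + (((n + 1 : ℕ) : ℤ), 0) - (1, 0) := by
        ext
        · simp
          ring
        · simp
      rw [ih]
      refine connectedComponentIn_squareCenter_eq (e := vEdge (z + (((n + 1 : ℕ) : ℤ), 0)))
        ?_ (vEdge_mem_squareEdges.2 (.inr hsub)) (vEdge_mem_squareEdges.2 (.inl rfl))
      rw [vEdge_mem_edgeBoundary, ← hsub, not_not]
      exact iff_of_false (h _) (h _)
  intro hb
  obtain ⟨R, hR⟩ := hb.exists_norm_le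
  obtain ⟨n, hn⟩ := exists_nat_gt (R - z.1)
  have hmem := mem_connectedComponentIn (F := (carrierOf (edgeBoundary A))ᶜ)
    (squareCenter_notMem_carrierOf A (z + ((n : ℤ), 0)))
  rw [← hcomp] at hmem
  have h1 := (le_abs_self _).trans ((norm_fst_le (squareCenter _)).trans (hR _ hmem))
  simp only [squareCenter, Prod.fst_add] at h1
  push_cast at h1
  linarith

theorem not_isBounded_connectedComponentIn_squareCenter {A : Set GridV} (hA : A.Finite)
    (hcyc : IsCycle (edgeBoundary A)) {z : GridV} (hz : z ∉ A) : ¬ Bornology.IsBounded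
      (connectedComponentIn (carrierOf (edgeBoundary A))ᶜ (squareCenter z)) := by
  intro hzb
  set B : Set GridV := {w | Bornology.IsBounded
    (connectedComponentIn (carrierOf (edgeBoundary A))ᶜ (squareCenter w))} with hB
  have hsub : edgeBoundary B ⊆ edgeBoundary A := by
    rintro e ⟨a, ha, b, hb, hea, heb⟩
    by_contra he
    refine hb ?_
    rw [hB, Set.mem_ofPred_eq, ← connectedComponentIn_squareCenter_eq he hea heb]
    exact ha
  obtain ⟨n, hn⟩ := exists_right_notMem hA z
  have hfar : z + ((n : ℤ), 0) ∉ B := by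
    refine not_isBounded_of_forall_right_notMem fun m => ?_
    have hadd : z + ((n : ℤ), 0) + ((m : ℤ), 0) = z + (((n + m : ℕ) : ℤ), 0) := by
      ext <;> simp [add_assoc]
    rw [hadd]
    exact hn _ (Nat.le_add_right n m)
  have hzB : z ∈ B := hzb
  rcases (edgeBoundary B).eq_empty_or_nonempty with h | h
  · have := mem_iff_mem_add_of_edgeBoundary_eq (h.trans edgeBoundary_empty.symm) z n
    simp only [Set.mem_empty_iff_false] at this
    tauto
  · have := mem_iff_mem_add_of_edgeBoundary_eq (hcyc.edgeBoundary_eq_of_subset hsub h) z n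
    have := hn n le_rfl
    tauto

theorem inInterior_squareSet {A : Set GridV} (hA : A.Finite) {z : GridV} (hz : z ∈ A) :
    inInterior (edgeBoundary A) (squareSet z) := by
  intro p hp
  by_cases hpA : p ∈ carrierOf (edgeBoundary A)
  · exact .inr hpA
  · refine .inl ⟨hpA, ?_⟩
    rw [connectedComponentIn_eq_squareCenter hp hpA]
    exact isBounded_connectedComponentIn_squareCenter hA hz

theorem inExterior_squareSet {A : Set GridV} (hA : A.Finite) (hcyc : IsCycle (edgeBoundary A))
    {z : GridV} (hz : z ∉ A) : inExterior (edgeBoundary A) (squareSet z) := by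
  intro p hp
  by_cases hpA : p ∈ carrierOf (edgeBoundary A)
  · exact .inr hpA
  · refine .inl ⟨hpA, ?_⟩
    rw [connectedComponentIn_eq_squareCenter hp hpA]
    exact not_isBounded_connectedComponentIn_squareCenter hA hcyc hz

theorem subset_carrierOf_of_inInterior_of_inExterior {E : Set (Sym2 GridV)} {S : Set (ℝ × ℝ)}
    (hi : inInterior E S) (ho : inExterior E S) : S ⊆ carrierOf E := by
  intro p hp
  rcases hi hp with h | h
  · rcases ho hp with h' | h'
    exacts [absurd h.2 h'.2, h']
  · exact h

theorem mem_of_inInterior_squareSet {A : Set GridV} (hA : A.Finite)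
    (hcyc : IsCycle (edgeBoundary A)) {z : GridV} (h : inInterior (edgeBoundary A) (squareSet z)) :
    z ∈ A :=
  by_contra fun hz => squareCenter_notMem_carrierOf A z <|
    subset_carrierOf_of_inInterior_of_inExterior h (inExterior_squareSet hA hcyc hz)
      (squareCenter_mem z)

theorem mem_edgeBoundary_of_edgeSeg_subset {A : Set GridV} {e : Sym2 GridV} {z : GridV}
    (hz : e ∈ squareEdges z) (h : edgeSeg e ⊆ carrierOf (edgeBoundary A)) :
    e ∈ edgeBoundary A := by
  by_contra he
  obtain ⟨m, hm, hmA⟩ := exists_mem_edgeSeg_notMem_carrierOf hz he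
  exact hmA (h hm)

/-! ### Outermost cycles -/

theorem exists_mem_squareEdges {ω : GridV → Prop} {e : Sym2 GridV} (he : e ∈ gcEdges ω) :
    ∃ z ∈ starComp ω, e ∈ squareEdges z := by
  simpa [gcEdges] using he

theorem mem_starComp_of_starAdj {ω : GridV → Prop} {z w : GridV} (hz : z ∈ starComp ω) (hw : ω w)
    (h : starAdj z w) : w ∈ starComp ω :=
  ⟨hw, hz.2.tail ⟨hz.1, hw, h⟩⟩

theorem squareEdges_subset_gcEdges {ω : GridV → Prop} {z : GridV} (hz : z ∈ starComp ω) :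
    squareEdges z ⊆ gcEdges ω := Set.subset_biUnion_of_mem hz

theorem gcEdges_finite {ω : GridV → Prop} (hfin : (starComp ω).Finite) : (gcEdges ω).Finite :=
  hfin.biUnion fun z _ => squareEdges_finite z

/-- Two plus-connected sets of squares with a common edge are enclosed by a single cycle. -/
theorem exists_isCycleIn_union {G : Set (Sym2 GridV)} {A B : Set GridV} (hA : A.Finite)
    (hB : B.Finite) (hAi : Indecomposable A) (hBi : Indecomposable B)
    (hAG : edgeBoundary A ⊆ G) (hBG : edgeBoundary B ⊆ G) {e : Sym2 GridV} {a b : GridV}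
    (ha : a ∈ A) (hb : b ∈ B) (hea : e ∈ squareEdges a) (heb : e ∈ squareEdges b) :
    ∃ F, A ∪ B ⊆ F ∧ F.Finite ∧ IsCycleIn G (edgeBoundary F) := by
  obtain ⟨F, hF, hFfin, hcyc, hsub⟩ :=
    (hAi.union hBi ha hb hea heb).exists_isCycle (hA.union hB) ⟨a, .inl ha⟩
  exact ⟨F, hF, hFfin, hcyc,
    hsub.trans ((edgeBoundary_union_subset A B).trans (Set.union_subset hAG hBG))⟩

/-- Every occupied square of the component has an outermost boundary cycle. -/
theorem exists_isOutermostCycleOf {ω : GridV → Prop} (hfin : (starComp ω).Finite) {z : GridV}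
    (hz : z ∈ starComp ω) :
    ∃ A, A.Finite ∧ z ∈ A ∧ isOutermostCycleOf ω z (edgeBoundary A) := by
  let S : Set (Set GridV) := {A | A.Finite ∧ z ∈ A ∧ IsCycleIn (gcEdges ω) (edgeBoundary A)}
  have hS : S.Finite := (finite_setOf_edgeBoundary_subset (gcEdges_finite hfin)).subset
    fun A hA => ⟨hA.1, hA.2.2.2⟩
  have hSne : S.Nonempty := by
    obtain ⟨A, hzA, hA, hcyc, hsub⟩ := (indecomposable_singleton z).exists_isCycle
      (Set.finite_singleton z) (Set.singleton_nonempty z)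
    exact ⟨A, hA, hzA rfl, hcyc, hsub.trans ((edgeBoundary_singleton_subset z).trans
      (squareEdges_subset_gcEdges hz))⟩
  obtain ⟨A, ⟨hA, hzA, hcyc, hAG⟩, hmax⟩ := hS.exists_maximal hSne
  have hAi := indecomposable_of_isCycle hA hcyc
  have hmerge : ∀ B : Set GridV, B.Finite → Indecomposable B → edgeBoundary B ⊆ gcEdges ω →
      ∀ e, ∀ a ∈ A, ∀ b ∈ B, e ∈ squareEdges a → e ∈ squareEdges b → B ⊆ A := by
    intro B hB hBi hBG e a ha b hb hea heb
    obtain ⟨F, hF, hFfin, hFcyc⟩ :=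
      exists_isCycleIn_union hA hB hAi hBi hAG hBG ha hb hea heb
    exact Set.subset_union_right.trans <| hF.trans <|
      hmax ⟨hFfin, hF (.inl hzA), hFcyc⟩ (Set.subset_union_left.trans hF)
  refine ⟨A, hA, hzA, ⟨hcyc, hAG⟩, inInterior_squareSet hA hzA, ?_, ?_⟩
  · intro e he
    obtain ⟨a, ha, b, hb, hea, heb⟩ := id he
    obtain ⟨c, -, hadj, hc⟩ := exists_sides hea
    have hbc : b = c := ((hc b).1 heb).resolve_left fun h => hb (h ▸ ha)
    subst hbc
    have hbC : b ∉ starComp ω := fun hbC => hb <| hmerge {b} (Set.finite_singleton b)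
      (indecomposable_singleton b) ((edgeBoundary_singleton_subset b).trans
        (squareEdges_subset_gcEdges hbC)) e a ha b rfl hea heb rfl
    have haC : a ∈ starComp ω := by
      obtain ⟨d, hd, hed⟩ := exists_mem_squareEdges (hAG he)
      rcases (hc d).1 hed with rfl | rfl
      exacts [hd, absurd hd hbC]
    exact ⟨⟨a, haC, hea, inInterior_squareSet hA ha⟩,
      b, fun hbω => hbC (mem_starComp_of_starAdj haC hbω hadj), heb,
      inExterior_squareSet hA hcyc hb⟩
  · rintro C ⟨hC, hCG⟩ hzC e he
    obtain ⟨B, hB, rfl⟩ := hC.exists_eq_edgeBoundary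
    have hzB := mem_of_inInterior_squareSet hB hC hzC
    have hz' : hEdge z ∈ squareEdges z := hEdge_mem_squareEdges.2 (.inl rfl)
    have hBA := hmerge B hB (indecomposable_of_isCycle hB hC) hCG _ z hzA z hzB hz' hz'
    obtain ⟨a, ha, -, -, hea, -⟩ := he
    exact .inr ((edgeSeg_subset_squareSet hea).trans (inInterior_squareSet hA (hBA ha)))

/-- A cycle enclosing all squares enclosed by an outermost cycle encloses no others. -/
theorem isOutermostCycleOf.eq_of_subset {ω : GridV → Prop} {z : GridV} {A F : Set GridV}
    (hA : A.Finite) (hD : isOutermostCycleOf ω z (edgeBoundary A)) (hF : F.Finite) (hAF : A ⊆ F)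
    (hcyc : IsCycleIn (gcEdges ω) (edgeBoundary F)) : F = A := by
  have hzA := mem_of_inInterior_squareSet hA hD.1.1 hD.2.1
  have hsub : edgeBoundary F ⊆ edgeBoundary A := by
    intro e he
    refine (hD.2.2.2 _ hcyc (inInterior_squareSet hF (hAF hzA)) e he).elim id fun hint => ?_
    obtain ⟨-, -, b, hb, -, heb⟩ := he
    refine mem_edgeBoundary_of_edgeSeg_subset heb
      (subset_carrierOf_of_inInterior_of_inExterior hint ?_)
    exact (edgeSeg_subset_squareSet heb).trans
      (inExterior_squareSet hA hD.1.1 fun h => hb (hAF h))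
  exact edgeBoundary_injOn_finite hF hA
    (hD.1.1.edgeBoundary_eq_of_subset hsub hcyc.1.nonempty)

/-- If `C(0)` is finite and nonempty, an edge `e` of `G_C` is an
outermost boundary edge of `C(0)` iff `e` is an edge of the outermost boundary cycle
`D_k` of some occupied square `S_k ∈ C(0)`. -/
theorem outermost_boundary_edge_iff (ω : GridV → Prop)
    (hfin : (starComp ω).Finite) (hne : (starComp ω).Nonempty)
    (e : Sym2 GridV) (he : e ∈ gcEdges ω) :
    outermostBoundaryEdgeIn (gcEdges ω) e ↔
      ∃ z ∈ starComp ω, ∃ D, isOutermostCycleOf ω z D ∧ e ∈ D := by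
  constructor
  · rintro ⟨-, hout⟩
    obtain ⟨z, hz, hez⟩ := exists_mem_squareEdges he
    obtain ⟨A, hA, hzA, hD⟩ := exists_isOutermostCycleOf hfin hz
    refine ⟨z, hz, _, hD, (hout _ hD.1).elim id fun hext => ?_⟩
    exact mem_edgeBoundary_of_edgeSeg_subset hez (subset_carrierOf_of_inInterior_of_inExterior
      ((edgeSeg_subset_squareSet hez).trans (inInterior_squareSet hA hzA)) hext)
  · rintro ⟨z, -, D, hD, heD⟩
    refine ⟨he, fun E ⟨hE, hEG⟩ => or_iff_not_imp_left.2 fun heE => ?_⟩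
    obtain ⟨A, hA, rfl⟩ := hD.1.1.exists_eq_edgeBoundary
    obtain ⟨B, hB, rfl⟩ := hE.exists_eq_edgeBoundary
    obtain ⟨a, ha, b, hb, hea, heb⟩ := heD
    by_cases haB : a ∈ B
    · have hbB := mem_of_notMem_edgeBoundary heE hea heb haB
      obtain ⟨F, hF, hFfin, hFcyc⟩ := exists_isCycleIn_union hA hB
        (indecomposable_of_isCycle hA hD.1.1) (indecomposable_of_isCycle hB hE) hD.1.2 hEG ha haB
        hea hea
      have hFA := hD.eq_of_subset hA hFfin (Set.subset_union_left.trans hF) hFcyc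
      exact absurd (hFA ▸ hF (.inr hbB)) hb
    · exact (edgeSeg_subset_squareSet hea).trans (inExterior_squareSet hB hE haB)
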